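/- arXiv:math/0607407 — 2 statements merged into one kernel-verified Lean document; each statement's English description precedes it below -/
import Mathlib

section
/- Let c ≠ 0 and σ be real numbers with 0 < σ² < 1, and define the Leapfrog group velocity V_g(φ) = c·cos φ / √(1 − σ²·sin²φ). Then for every real φ, the derivative of V_g vanishes at φ if and only if sin φ = 0 (i.e. φ = 0 mod π); moreover at these points V_g takes the values V_g(0) = c and V_g(π) = −c, so the corresponding caustic speed is U_c = ±c. -/
lemma one_sub_sq_mul_sin_sq_pos {σ : ℝ} (hσ : σ ^ 2 < 1) (φ : ℝ) :
    0 < 1 - σ ^ 2 * Real.sin φ ^ 2 := by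
  nlinarith [Real.sin_sq_le_one φ, sq_nonneg σ, sq_nonneg (Real.sin φ)]

lemma hasDerivAt_leapfrog_groupVelocity (c : ℝ) {σ : ℝ} (hσ : σ ^ 2 < 1) (φ : ℝ) :
    HasDerivAt (fun φ : ℝ => c * Real.cos φ / Real.sqrt (1 - σ ^ 2 * Real.sin φ ^ 2))
      (c * (σ ^ 2 - 1) * Real.sin φ / Real.sqrt (1 - σ ^ 2 * Real.sin φ ^ 2) ^ 3) φ := by
  have hpos := one_sub_sq_mul_sin_sq_pos hσ φ
  have hs := Real.sqrt_pos.2 hpos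
  have hsq := Real.sq_sqrt hpos.le
  have hden := (((((Real.hasDerivAt_sin φ).pow 2).const_mul (σ ^ 2)).const_sub 1).sqrt hpos.ne')
  refine (((Real.hasDerivAt_cos φ).const_mul c).div hden hs.ne').congr_deriv ?_
  simp only [Pi.pow_apply, Nat.cast_ofNat]
  set s := Real.sqrt (1 - σ ^ 2 * Real.sin φ ^ 2)
  have hs0 := hs.ne'
  field_simp
  rw [hsq]
  linear_combination (c * Real.sin φ * σ ^ 2) * Real.sin_sq_add_cos_sq φ

/-- For the Leapfrog scheme with `c ≠ 0` and `0 < σ² < 1`, the derivative of the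
group velocity `V_g(φ) = c cos φ / √(1 − σ² sin² φ)` vanishes at `φ` iff
`sin φ = 0` (i.e. `φ = 0 mod π`), and the caustic speeds are `V_g(0) = c`,
`V_g(π) = −c`, i.e. `U_c = ± c`. -/
theorem leapfrog_caustics (c σ : ℝ) (hc : c ≠ 0) (h0 : 0 < σ ^ 2) (h1 : σ ^ 2 < 1)
    (Vg : ℝ → ℝ)
    (hVg : Vg = fun φ : ℝ => c * Real.cos φ / Real.sqrt (1 - σ ^ 2 * Real.sin φ ^ 2)) :
    (∀ φ : ℝ, deriv Vg φ = 0 ↔ Real.sin φ = 0) ∧ Vg 0 = c ∧ Vg Real.pi = -c := by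
  subst hVg
  refine ⟨fun φ => ?_, by simp, by simp⟩
  have hs := (Real.sqrt_pos.2 (one_sub_sq_mul_sin_sq_pos h1 φ)).ne'
  rw [(hasDerivAt_leapfrog_groupVelocity c h1 φ).deriv]
  simp [hc, sub_ne_zero.2 h1.ne, hs]
end

section
/- Let α > 0, k, x₀, c, V be real numbers with V ≠ c, and for each t define the wave-packet error E(t) = sup over x ∈ ℝ of | e^{−α(x−x₀−ct)²}·cos(k(x−x₀−ct)) − e^{−α(x−x₀−Vt)²}·cos(k(x−x₀−Vt)) |. Then E(t) tends to 1 as t → +∞, and 1 = sup over x ∈ ℝ of | e^{−α(x−x₀)²}·cos(k(x−x₀)) |, i.e. the L∞ norm of the error between the exact advected packet and the dispersively advected packet converges to the L∞ norm of the initial packet. -/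
theorem abs_exp_mul_cos_le (r θ : ℝ) : |Real.exp r * Real.cos θ| ≤ Real.exp r := by
  rw [abs_mul, Real.abs_exp]
  exact mul_le_of_le_one_right (Real.exp_pos r).le (Real.abs_cos_le_one θ)

/-- Two Gaussians centred at distance `|a - b|` overlap at most by `exp (-α (a - b)² / 4)`. -/
theorem exp_neg_mul_sq_add_le {α : ℝ} (hα : 0 ≤ α) (a b : ℝ) :
    Real.exp (-α * a ^ 2) + Real.exp (-α * b ^ 2) ≤ 1 + Real.exp (-α * ((a - b) ^ 2 / 4)) := by
  have le_one (y : ℝ) : Real.exp (-α * y ^ 2) ≤ 1 :=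
    Real.exp_le_one_iff.2 (by nlinarith [mul_nonneg hα (sq_nonneg y)])
  have decay {y : ℝ} (hy : (a - b) ^ 2 / 4 ≤ y ^ 2) :
      Real.exp (-α * y ^ 2) ≤ Real.exp (-α * ((a - b) ^ 2 / 4)) :=
    Real.exp_le_exp.2 (mul_le_mul_of_nonpos_left hy (neg_nonpos.2 hα))
  rcases le_total (a ^ 2) (b ^ 2) with h | h
  · exact add_le_add (le_one a) (decay (by nlinarith [sq_nonneg (a + b)]))
  · rw [add_comm]
    exact add_le_add (le_one b) (decay (by nlinarith [sq_nonneg (a + b)]))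

open Filter

/-- Two copies of the same sinusoidal wave packet, one advected at the exact
speed `c` and one at the numerical group velocity `V ≠ c`: the `L∞` norm of
their difference
`E(t) = sup_x |e^{−α(x−x₀−ct)²} cos(k(x−x₀−ct)) − e^{−α(x−x₀−Vt)²} cos(k(x−x₀−Vt))|`
tends to `1` as `t → +∞`, and `1` is the `L∞` norm of the initial packet. -/
theorem wave_packet_error_limit (α k x₀ c V : ℝ) (hα : 0 < α) (hV : V ≠ c)
    (E : ℝ → ℝ)
    (hE : E = fun t : ℝ => ⨆ x : ℝ,
      |Real.exp (-α * (x - x₀ - c * t) ^ 2) * Real.cos (k * (x - x₀ - c * t))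
        - Real.exp (-α * (x - x₀ - V * t) ^ 2) * Real.cos (k * (x - x₀ - V * t))|) :
    Tendsto E atTop (nhds 1) ∧
    (1 : ℝ) = ⨆ x : ℝ, |Real.exp (-α * (x - x₀) ^ 2) * Real.cos (k * (x - x₀))| := by
  have upper (t x : ℝ) :
      |Real.exp (-α * (x - x₀ - c * t) ^ 2) * Real.cos (k * (x - x₀ - c * t))
        - Real.exp (-α * (x - x₀ - V * t) ^ 2) * Real.cos (k * (x - x₀ - V * t))|
        ≤ 1 + Real.exp (-α * (((V - c) * t) ^ 2 / 4)) := by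
    have h := exp_neg_mul_sq_add_le hα.le (x - x₀ - c * t) (x - x₀ - V * t)
    rw [show x - x₀ - c * t - (x - x₀ - V * t) = (V - c) * t by ring] at h
    exact ((abs_sub _ _).trans
      (add_le_add (abs_exp_mul_cos_le _ _) (abs_exp_mul_cos_le _ _))).trans h
  have lower (t : ℝ) : 1 - Real.exp (-α * (((V - c) * t) ^ 2 / 4)) ≤ E t := by
    rw [hE]
    refine le_trans ?_ (le_ciSup ⟨_, Set.forall_mem_range.2 (upper t)⟩ (x₀ + c * t))
    have hc : x₀ + c * t - x₀ - c * t = 0 := by ring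
    have hd : x₀ + c * t - x₀ - V * t = -((V - c) * t) := by ring
    have hexp : Real.exp (-α * (-((V - c) * t)) ^ 2)
        ≤ Real.exp (-α * (((V - c) * t) ^ 2 / 4)) :=
      Real.exp_le_exp.2 (mul_le_mul_of_nonpos_left
        (by nlinarith [sq_nonneg ((V - c) * t)]) (neg_nonpos.2 hα.le))
    have hcos := (le_abs_self _).trans
      (abs_exp_mul_cos_le (-α * (-((V - c) * t)) ^ 2) (k * -((V - c) * t)))
    have hone : Real.exp (-α * 0 ^ 2) * Real.cos (k * 0) = 1 := by norm_num
    simp only [hc, hd, hone]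
    exact (sub_le_sub_left (hcos.trans hexp) 1).trans (le_abs_self _)
  have decay : Tendsto (fun t : ℝ => Real.exp (-α * (((V - c) * t) ^ 2 / 4))) atTop (nhds 0) := by
    have hpos : 0 < α * (V - c) ^ 2 / 4 := by
      have := sub_ne_zero.2 hV
      positivity
    refine Real.tendsto_exp_neg_atTop_nhds_zero.comp
      ((tendsto_pow_atTop two_ne_zero).const_mul_atTop hpos) |>.congr fun t => ?_
    simp only [Function.comp_apply]
    ring_nf
  refine ⟨tendsto_of_tendsto_of_tendsto_of_le_of_le (by simpa only [sub_zero] using decay.const_sub 1)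
    (by simpa only [add_zero] using decay.const_add 1) lower fun t => ?_, ?_⟩
  · rw [hE]
    exact ciSup_le (upper t)
  · have bound (x : ℝ) : |Real.exp (-α * (x - x₀) ^ 2) * Real.cos (k * (x - x₀))| ≤ 1 :=
      (abs_exp_mul_cos_le _ _).trans
        (Real.exp_le_one_iff.2 (by nlinarith [mul_nonneg hα.le (sq_nonneg (x - x₀))]))
    refine le_antisymm ?_ (ciSup_le bound)
    simpa using le_ciSup ⟨1, Set.forall_mem_range.2 bound⟩ x₀
end
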